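/- arXiv:1612.02185 — 2 statements merged into one kernel-verified Lean document; each statement's English description precedes it below -/
import Mathlib

section
/- A non-identity element (σ,v) of G_n is an involution if and only if σ, written as a product of disjoint signed cycles, consists solely of positive 2-cycles and (positive or negative) 1-cycles, and writing v = (v_1,…,v_n): for each positive 2-cycle (a b)⁺ of σ one has v_b = −v_a, for each negative 2-cycle entry, i.e. each 2-cycle (a b)⁻ of σ, one has v_b = v_a, and for each positive 1-cycle (d)⁺ of σ one has v_d = 0 (there is no restriction on v_c for negative 1-cycles (c)⁻). -/
/-!
Common setup: the affine Weyl group of type C̃ₙ, realized as the semidirect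
product of the group Wₙ of signed permutations of {1,…,n} with the translation
lattice ℤⁿ.  An element is a triple `(π, s, v)`, where `π` is the underlying
permutation of the n points, `s i` is the sign attached to the point `i`
(so the signed permutation maps the point `i` to the point `π i` with sign `s i`),
and `v ∈ ℤⁿ` is the translation part.  The multiplication realizes
`(α,v)(τ,u) = (ατ, vᵗ + u)`.
-/

/-- An element of the affine Weyl group of type C̃ₙ: a signed permutation
`(π, s)` together with a translation vector `v ∈ ℤⁿ`. -/
@[ext]
structure AffineWeylC (n : ℕ) where
  π : Equiv.Perm (Fin n)
  s : Fin n → ℤˣ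
  v : Fin n → ℤ

namespace AffineWeylC

variable {n : ℕ}

instance : One (AffineWeylC n) := ⟨⟨1, 1, 0⟩⟩

instance : Mul (AffineWeylC n) :=
  ⟨fun g h => ⟨h.π * g.π, fun j => g.s j * h.s (g.π j),
    fun i => (h.s (h.π⁻¹ i) : ℤ) * g.v (h.π⁻¹ i) + h.v i⟩⟩

instance : Inv (AffineWeylC n) :=
  ⟨fun g => ⟨g.π⁻¹, fun k => (g.s (g.π⁻¹ k))⁻¹,
    fun i => -(((g.s i)⁻¹ : ℤˣ) : ℤ) * g.v (g.π i)⟩⟩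

@[simp] lemma mul_π (g h : AffineWeylC n) : (g * h).π = h.π * g.π := rfl
@[simp] lemma mul_s (g h : AffineWeylC n) (j : Fin n) :
    (g * h).s j = g.s j * h.s (g.π j) := rfl
@[simp] lemma mul_v (g h : AffineWeylC n) (i : Fin n) :
    (g * h).v i = (h.s (h.π⁻¹ i) : ℤ) * g.v (h.π⁻¹ i) + h.v i := rfl
@[simp] lemma one_π : (1 : AffineWeylC n).π = 1 := rfl
@[simp] lemma one_s (j : Fin n) : (1 : AffineWeylC n).s j = 1 := rfl
@[simp] lemma one_v (i : Fin n) : (1 : AffineWeylC n).v i = 0 := rfl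
@[simp] lemma inv_π (g : AffineWeylC n) : g⁻¹.π = g.π⁻¹ := rfl
@[simp] lemma inv_s (g : AffineWeylC n) (k : Fin n) :
    g⁻¹.s k = (g.s (g.π⁻¹ k))⁻¹ := rfl
@[simp] lemma inv_v (g : AffineWeylC n) (i : Fin n) :
    g⁻¹.v i = -(((g.s i)⁻¹ : ℤˣ) : ℤ) * g.v (g.π i) := rfl

instance : Group (AffineWeylC n) where
  mul_assoc a b c := by
    refine AffineWeylC.ext ?_ (funext fun j => ?_) (funext fun i => ?_)
    · simp [mul_assoc]
    · simp only [mul_s, mul_π, Equiv.Perm.mul_apply]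
      rw [mul_assoc]
    · simp only [mul_v, mul_s, mul_π, mul_inv_rev, Equiv.Perm.mul_apply,
        (show ∀ (e : Equiv.Perm (Fin n)) (x : Fin n), e (e⁻¹ x) = x from
          fun e x => e.apply_symm_apply x), Units.val_mul]
      ring
  one_mul a := by
    refine AffineWeylC.ext ?_ (funext fun j => ?_) (funext fun i => ?_) <;>
      simp
  mul_one a := by
    refine AffineWeylC.ext ?_ (funext fun j => ?_) (funext fun i => ?_) <;>
      simp
  inv_mul_cancel a := by
    refine AffineWeylC.ext ?_ (funext fun j => ?_) (funext fun i => ?_)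
    · simp
    · simp
    · simp only [mul_v, inv_v, inv_s, one_v, (show ∀ (e : Equiv.Perm (Fin n)) (x : Fin n), e (e⁻¹ x) = x from
          fun e x => e.apply_symm_apply x)]
      have h1 : ((a.s (a.π⁻¹ i) : ℤ)) * (((a.s (a.π⁻¹ i))⁻¹ : ℤˣ) : ℤ) = 1 := by
        rw [← Units.val_mul, mul_inv_cancel, Units.val_one]
      linear_combination (-(a.v i)) * h1

/-- `g` is an involution: a non-identity element squaring to the identity. -/
def Involution (g : AffineWeylC n) : Prop := g ≠ 1 ∧ g * g = 1

/-- The conjugacy class of `a`. -/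
def conjClass (a : AffineWeylC n) : Set (AffineWeylC n) := {b | IsConj a b}

/-- The number of transpositions (2-cycles) of the underlying signed permutation. -/
noncomputable def numTrans (g : AffineWeylC n) : ℕ :=
  {i : Fin n | g.π i ≠ i}.ncard / 2

/-- The number of negative 1-cycles of `g` carrying an even label. -/
noncomputable def numNegEven (g : AffineWeylC n) : ℕ :=
  {i : Fin n | g.π i = i ∧ g.s i = -1 ∧ Even (g.v i)}.ncard

/-- The number of negative 1-cycles of `g` carrying an odd label. -/
noncomputable def numNegOdd (g : AffineWeylC n) : ℕ :=
  {i : Fin n | g.π i = i ∧ g.s i = -1 ∧ Odd (g.v i)}.ncard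

/-- The number of positive 1-cycles (fixed points) of `g`. -/
noncomputable def numPos (g : AffineWeylC n) : ℕ :=
  {i : Fin n | g.π i = i ∧ g.s i = 1}.ncard

/-- The labelled cycle type `(m, k_e, k_o, l)` of an involution. -/
noncomputable def cycleType (g : AffineWeylC n) : ℕ × ℕ × ℕ × ℕ :=
  (numTrans g, numNegEven g, numNegOdd g, numPos g)

/-- `g` has labelled cycle type `(m, k_e, k_o, l)`. -/
def HasType (g : AffineWeylC n) (m ke ko l : ℕ) : Prop :=
  numTrans g = m ∧ numNegEven g = ke ∧ numNegOdd g = ko ∧ numPos g = l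

/-- The canonical class representative
`a_{m,k_e,k_o,l} = (1 2)⁺₀ ⋯ (2m−1 2m)⁺₀ (2m+1)⁻₀ ⋯ (2m+k_e)⁻₀
(2m+k_e+1)⁻₁ ⋯ (n−l)⁻₁ (n−l+1)⁺₀ ⋯ (n)⁺₀`
(here written with 0-based indices): points `0,…,2m-1` are paired off into
label‑0 positive transpositions, points `2m,…,2m+k_e-1` are negative 1-cycles
with label 0, points `2m+k_e,…,2m+k_e+k_o-1` are negative 1-cycles with label 1,
and the remaining `l` points are positive fixed points with label 0. -/
def IsCanon (a : AffineWeylC n) (m ke ko l : ℕ) : Prop :=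
  2*m + ke + ko + l = n ∧
  (∀ i : Fin n, i.val < 2*m → i.val % 2 = 0 → (a.π i).val = i.val + 1) ∧
  (∀ i : Fin n, i.val < 2*m → i.val % 2 = 1 → (a.π i).val = i.val - 1) ∧
  (∀ i : Fin n, 2*m ≤ i.val → a.π i = i) ∧
  (∀ i : Fin n, i.val < 2*m → a.s i = 1 ∧ a.v i = 0) ∧
  (∀ i : Fin n, 2*m ≤ i.val → i.val < 2*m + ke → a.s i = -1 ∧ a.v i = 0) ∧
  (∀ i : Fin n, 2*m + ke ≤ i.val → i.val < 2*m + ke + ko → a.s i = -1 ∧ a.v i = 1) ∧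
  (∀ i : Fin n, 2*m + ke + ko ≤ i.val → a.s i = 1 ∧ a.v i = 0)

/-- The labelled positive transposition `(α β)⁺_λ`. -/
def posTrans (α β : Fin n) (lam : ℤ) : AffineWeylC n :=
  ⟨Equiv.swap α β, 1, fun i => if i = α then lam else if i = β then -lam else 0⟩

/-- The labelled negative transposition `(α β)⁻_λ`. -/
def negTrans (α β : Fin n) (lam : ℤ) : AffineWeylC n :=
  ⟨Equiv.swap α β, fun i => if i = α then -1 else if i = β then -1 else 1,
    fun i => if i = α then lam else if i = β then lam else 0⟩

/-- The labelled negative 1-cycle `(α)⁻_λ`. -/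
def negOne (α : Fin n) (lam : ℤ) : AffineWeylC n :=
  ⟨1, fun i => if i = α then -1 else 1, fun i => if i = α then lam else 0⟩

/-- The finite Weyl group Wₙ of type Cₙ, as the subgroup of the affine Weyl
group consisting of the elements with trivial translation part. -/
def WeylSub (n : ℕ) : Subgroup (AffineWeylC n) where
  carrier := {g | g.v = 0}
  one_mem' := rfl
  mul_mem' := by
    intro g h hg hh
    show (g * h).v = 0
    funext i
    simp only [mul_v]
    rw [show g.v = 0 from hg, show h.v = 0 from hh]
    simp
  inv_mem' := by
    intro g hg
    show g⁻¹.v = 0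
    funext i
    simp only [inv_v]
    rw [show g.v = 0 from hg]
    simp

/-- The projection `G_n → W_n`, `(σ, v) ↦ σ`. -/
def weylPart (n : ℕ) : AffineWeylC n →* WeylSub n where
  toFun g := ⟨⟨g.π, g.s, 0⟩, rfl⟩
  map_one' := by
    apply Subtype.ext
    refine AffineWeylC.ext rfl rfl rfl
  map_mul' g h := by
    apply Subtype.ext
    refine AffineWeylC.ext rfl rfl (funext fun i => ?_)
    simp

end AffineWeylC

/-- The commuting graph on a subset `X` of a group: the vertices are the
elements of `X`, and distinct vertices are adjacent iff they commute. -/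
def commGraph {G : Type*} [Group G] (X : Set G) : SimpleGraph X where
  Adj x y := (x : G) ≠ (y : G) ∧ Commute (x : G) (y : G)
  symm := ⟨fun _ _ h => ⟨fun e => h.1 e.symm, h.2.symm⟩⟩
  loopless := ⟨fun _ h => h.1 rfl⟩

/-- An element of `G_n` squares to the identity iff its permutation, sign and translation parts
satisfy the corresponding pointwise equations. -/
theorem AffineWeylC.mul_self_eq_one_iff {n : ℕ} (g : AffineWeylC n) :
    g * g = 1 ↔
      (∀ i, g.π (g.π i) = i) ∧
      (∀ i, g.s i * g.s (g.π i) = 1) ∧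
      (∀ i, (g.s i : ℤ) * g.v i + g.v (g.π i) = 0) := by
  simp only [AffineWeylC.ext_iff, funext_iff, Equiv.ext_iff, mul_π, mul_s, mul_v, one_π, one_s,
    one_v, Equiv.Perm.mul_apply, Equiv.Perm.one_apply]
  refine and_congr_right fun _ => and_congr_right fun _ => ?_
  rw [← g.π.forall_congr_right]
  simp

/-- A non-identity element `g = (σ, v)` of `G_n` is an involution
iff `σ` has only 1-cycles and positive 2-cycles, and the labels satisfy:
`v_b = -v_a` on 2-cycles `(a b)` whose points carry `+` signs, `v_b = v_a` on
2-cycles whose points carry `-` signs, and `v_d = 0` on positive fixed points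
(no restriction on the labels of negative 1-cycles). -/
theorem stmt_2 (n : ℕ) (g : AffineWeylC n) (hg : g ≠ 1) :
    g * g = 1 ↔
      ((∀ i, g.π (g.π i) = i) ∧
       (∀ i, g.π i ≠ i → g.s i * g.s (g.π i) = 1) ∧
       (∀ i, g.π i ≠ i → g.s i = 1 → g.v (g.π i) = - g.v i) ∧
       (∀ i, g.π i ≠ i → g.s i = -1 → g.v (g.π i) = g.v i) ∧
       (∀ i, g.π i = i → g.s i = 1 → g.v i = 0)) := by
  rw [AffineWeylC.mul_self_eq_one_iff]
  constructor
  · rintro ⟨hπ, hs, hv⟩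
    refine ⟨hπ, fun i _ => hs i, fun i _ h => ?_, fun i _ h => ?_, fun i hi h => ?_⟩
    · have := hv i
      rw [h, Units.val_one] at this
      linarith
    · have := hv i
      rw [h, Units.val_neg, Units.val_one] at this
      linarith
    · have := hv i
      rw [hi, h, Units.val_one] at this
      linarith
  · rintro ⟨hπ, hs, hpos, hneg, hfix⟩
    refine ⟨hπ, fun i => ?_, fun i => ?_⟩
    · by_cases hi : g.π i = i
      · rw [hi, Int.units_mul_self]
      · exact hs i hi
    · by_cases hi : g.π i = i <;> rcases Int.units_eq_one_or (g.s i) with h | h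
      · simp [hi, h, hfix i hi h]
      · simp [hi, h]
      · simp [h, hpos i hi h]
      · simp [h, hneg i hi h]
end

section
/- Two involutions in G_n are conjugate if and only if they have the same labelled cycle type (m,k_e,k_o,l). In particular, every involution of G_n is conjugate to exactly one element of the form a_{m,k_e,k_o,l} = (1 2)⁺₀ ⋯ (2m−1 2m)⁺₀ · (2m+1)⁻₀ ⋯ (2m+k_e)⁻₀ · (2m+k_e+1)⁻₁ ⋯ (n−l)⁻₁ · (n−l+1)⁺₀ ⋯ (n)⁺₀, where (a b)⁺₀ denotes a positive transposition with label 0, (c)⁻₀ and (c)⁻₁ denote negative 1-cycles with labels 0 and 1 respectively, and (d)⁺₀ denotes a positive fixed point with label 0. -/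
namespace AffineWeylC

variable {n : ℕ}

lemma perm_inv_apply_self (p : Equiv.Perm (Fin n)) (i : Fin n) : p⁻¹ (p i) = i :=
  p.symm_apply_apply i

lemma mul_eq_iff (c g h : AffineWeylC n) :
    c * g = h * c ↔ ∀ j, g.π (c.π j) = c.π (h.π j) ∧
      c.s j * g.s (c.π j) = h.s j * c.s (h.π j) ∧
      (g.s (c.π j) : ℤ) * c.v (c.π j) + g.v (g.π (c.π j)) =
        c.s (h.π j) * h.v (h.π j) + c.v (c.π (h.π j)) := by
  constructor
  · intro e j
    have hπ : g.π (c.π j) = c.π (h.π j) := congrArg (fun x => x.π j) e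
    refine ⟨hπ, congrArg (fun x => x.s j) e, ?_⟩
    have hv := congrArg (fun x => x.v (c.π (h.π j))) e
    simp only [mul_v, perm_inv_apply_self] at hv
    rw [← hπ, perm_inv_apply_self, hπ] at hv
    rwa [hπ]
  · intro H
    refine AffineWeylC.ext (Equiv.ext fun j => (H j).1) (funext fun j => (H j).2.1)
      (funext fun i => ?_)
    obtain ⟨k, rfl⟩ := c.π.surjective i
    obtain ⟨j, rfl⟩ := h.π.surjective k
    have := H j
    simp only [mul_v, perm_inv_apply_self]
    rw [← this.1, perm_inv_apply_self, this.1, ← this.2.2, this.1]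

lemma isConj_of_mul_eq {c g h : AffineWeylC n} (e : c * g = h * c) : IsConj g h :=
  isConj_iff.2 ⟨c, by rw [e, mul_inv_cancel_right]⟩

lemma π_π_of_mul_self {g : AffineWeylC n} (hg : g * g = 1) (i : Fin n) :
    g.π (g.π i) = i :=
  congrArg (fun x => x.π i) hg

lemma s_π_of_mul_self {g : AffineWeylC n} (hg : g * g = 1) (i : Fin n) :
    g.s (g.π i) = g.s i := by
  have h : g.s i * g.s (g.π i) = 1 := congrArg (fun x => x.s i) hg
  rw [← Int.units_inv_eq_self (g.s i)]
  exact eq_inv_of_mul_eq_one_right h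

lemma v_π_of_mul_self {g : AffineWeylC n} (hg : g * g = 1) (i : Fin n) :
    g.v (g.π i) = -(g.s i * g.v i) := by
  have h : (g.s (g.π⁻¹ (g.π i)) : ℤ) * g.v (g.π⁻¹ (g.π i)) + g.v (g.π i) = 0 :=
    congrArg (fun x => x.v (g.π i)) hg
  rw [perm_inv_apply_self] at h
  linarith

/-- The kind of cycle through a point: the smaller (`0`) or larger (`1`) point of a moved
pair, a positive 1-cycle (`2`), a negative 1-cycle with even (`3`) or odd (`4`) label. -/
def color (g : AffineWeylC n) (i : Fin n) : Fin 5 :=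
  if i < g.π i then 0 else if g.π i < i then 1 else if g.s i = 1 then 2
  else if Even (g.v i) then 3 else 4

lemma color_eq_zero {g : AffineWeylC n} {i : Fin n} : g.color i = 0 ↔ i < g.π i := by
  unfold color; split_ifs <;> simp_all

lemma color_eq_one {g : AffineWeylC n} {i : Fin n} : g.color i = 1 ↔ g.π i < i := by
  unfold color; split_ifs <;> grind

lemma color_eq_two {g : AffineWeylC n} {i : Fin n} :
    g.color i = 2 ↔ g.π i = i ∧ g.s i = 1 := by
  unfold color; split_ifs <;> grind

lemma color_eq_three {g : AffineWeylC n} {i : Fin n} :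
    g.color i = 3 ↔ g.π i = i ∧ g.s i = -1 ∧ Even (g.v i) := by
  have := Int.units_eq_one_or (g.s i)
  have : (1 : ℤˣ) ≠ -1 := by decide
  unfold color; split_ifs <;> grind

lemma color_eq_four {g : AffineWeylC n} {i : Fin n} :
    g.color i = 4 ↔ g.π i = i ∧ g.s i = -1 ∧ Odd (g.v i) := by
  have := Int.units_eq_one_or (g.s i)
  have : (1 : ℤˣ) ≠ -1 := by decide
  rw [← Int.not_even_iff_odd]
  unfold color; split_ifs <;> grind

/-- The number of points of a given color. -/
def colorCount (g : AffineWeylC n) (c : Fin 5) : ℕ :=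
  (Finset.univ.filter fun i => g.color i = c).card

lemma ncard_color (g : AffineWeylC n) (c : Fin 5) :
    {i | g.color i = c}.ncard = g.colorCount c := by
  rw [Set.ncard_eq_toFinset_card', colorCount]
  congr 1
  ext; simp

lemma numPos_eq (g : AffineWeylC n) : g.numPos = g.colorCount 2 := by
  simp only [numPos, ← ncard_color, color_eq_two]

lemma numNegEven_eq (g : AffineWeylC n) : g.numNegEven = g.colorCount 3 := by
  simp only [numNegEven, ← ncard_color, color_eq_three]

lemma numNegOdd_eq (g : AffineWeylC n) : g.numNegOdd = g.colorCount 4 := by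
  simp only [numNegOdd, ← ncard_color, color_eq_four]

lemma colorCount_one_eq {g : AffineWeylC n} (hg : g * g = 1) :
    g.colorCount 1 = g.colorCount 0 := by
  refine Finset.card_bij (fun i _ => g.π i) ?_ ?_ ?_
  · intro i hi
    simpa [color_eq_zero, color_eq_one, π_π_of_mul_self hg] using hi
  · intro i _ j _ h
    exact g.π.injective h
  · intro i hi
    exact ⟨g.π i, by simpa [color_eq_zero, color_eq_one, π_π_of_mul_self hg] using hi,
      π_π_of_mul_self hg i⟩

lemma numTrans_eq {g : AffineWeylC n} (hg : g * g = 1) : g.numTrans = g.colorCount 0 := by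
  have h : {i : Fin n | g.π i ≠ i} = {i | g.color i = 0} ∪ {i | g.color i = 1} := by
    ext i
    simp only [Set.mem_ofPred_eq, Set.mem_union, color_eq_zero, color_eq_one]
    rw [ne_comm, ne_iff_lt_or_gt]
  have hd : Disjoint {i | g.color i = 0} {i | g.color i = 1} :=
    Set.disjoint_left.2 fun i (h0 : _ = _) (h1 : _ = _) => by simp [h0] at h1
  rw [numTrans, h, Set.ncard_union_eq hd, ncard_color, ncard_color, colorCount_one_eq hg]
  omega

lemma sum_type_eq {g : AffineWeylC n} (hg : g * g = 1) :
    2 * g.numTrans + g.numNegEven + g.numNegOdd + g.numPos = n := by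
  have h := Finset.card_eq_sum_card_fiberwise (s := (Finset.univ : Finset (Fin n)))
    (t := Finset.univ) (f := g.color) (fun _ _ => Finset.mem_coe.2 (Finset.mem_univ _))
  rw [Finset.card_univ, Fintype.card_fin] at h
  change n = ∑ c, g.colorCount c at h
  rw [Fin.sum_univ_five, colorCount_one_eq hg] at h
  rw [numTrans_eq hg, numPos_eq, numNegEven_eq, numNegOdd_eq]
  omega

lemma colorCount_eq_of_cycleType_eq {g h : AffineWeylC n} (hg : g * g = 1) (hh : h * h = 1)
    (e : g.cycleType = h.cycleType) (c : Fin 5) : g.colorCount c = h.colorCount c := by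
  simp only [cycleType, numTrans_eq hg, numTrans_eq hh, numPos_eq, numNegEven_eq,
    numNegOdd_eq, Prod.mk.injEq] at e
  obtain ⟨h0, h3, h4, h2⟩ := e
  fin_cases c
  · exact h0
  · exact (colorCount_one_eq hg).trans (h0.trans (colorCount_one_eq hh).symm)
  · exact h2
  · exact h3
  · exact h4

/-- Replace all labels and signs by the standard ones of the same color. -/
def normalize (g : AffineWeylC n) : AffineWeylC n :=
  ⟨g.π, fun i => if g.color i = 3 ∨ g.color i = 4 then -1 else 1,
    fun i => if g.color i = 4 then 1 else 0⟩

@[simp] lemma normalize_π (g : AffineWeylC n) : g.normalize.π = g.π := rfl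
@[simp] lemma normalize_s (g : AffineWeylC n) (i : Fin n) :
    g.normalize.s i = if g.color i = 3 ∨ g.color i = 4 then -1 else 1 := rfl
@[simp] lemma normalize_v (g : AffineWeylC n) (i : Fin n) :
    g.normalize.v i = if g.color i = 4 then 1 else 0 := rfl

lemma isConj_normalize {g : AffineWeylC n} (hg : g * g = 1) : IsConj g g.normalize := by
  let c : AffineWeylC n := ⟨1, fun i => if g.color i = 1 then g.s i else 1,
    fun i => if g.color i = 0 then g.v i
      else if g.color i = 3 ∨ g.color i = 4 then g.v i / 2 else 0⟩
  refine isConj_of_mul_eq (c := c) ((mul_eq_iff _ _ _).2 fun j => ⟨rfl, ?_⟩)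
  have hπ := π_π_of_mul_self hg j
  have hs := s_π_of_mul_self hg j
  have hv := v_π_of_mul_self hg j
  rw [normalize_π]
  simp only [c, normalize_s, normalize_v, Equiv.Perm.one_apply]
  rcases lt_trichotomy j (g.π j) with hj | hj | hj
  · have h0 : g.color j = 0 := color_eq_zero.2 hj
    have h1 : g.color (g.π j) = 1 := color_eq_one.2 (by rwa [hπ])
    simp [h0, h1, hs, hv]
  · rw [← hj] at hv ⊢
    rcases Int.units_eq_one_or (g.s j) with h | h
    · have h2 : g.color j = 2 := color_eq_two.2 ⟨hj.symm, h⟩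
      have : g.v j = 0 := by simp only [h, Units.val_one] at hv; omega
      simp [h2, h, this]
    · rcases Int.even_or_odd (g.v j) with ho | ho
      · have h3 : g.color j = 3 := color_eq_three.2 ⟨hj.symm, h, ho⟩
        obtain ⟨k, hk⟩ := ho
        simp [h3, h]
        omega
      · have h4 : g.color j = 4 := color_eq_four.2 ⟨hj.symm, h, ho⟩
        obtain ⟨k, hk⟩ := ho
        simp [h4, h]
        omega
  · have h0 : g.color j = 1 := color_eq_one.2 hj
    have h1 : g.color (g.π j) = 0 := color_eq_zero.2 (by rwa [hπ])
    simp only [h0, h1, hv]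
    simp

lemma exists_perm_of_colorCount_eq {g h : AffineWeylC n} (hg : g * g = 1) (hh : h * h = 1)
    (e : ∀ c, g.colorCount c = h.colorCount c) :
    ∃ q : Equiv.Perm (Fin n), ∀ j, g.π (q j) = q (h.π j) ∧ g.color (q j) = h.color j := by
  let p : Equiv.Perm (Fin n) := Equiv.ofFiberEquiv (f := h.color) (g := g.color) fun c =>
    Fintype.equivOfCardEq (by
      rw [Fintype.card_subtype, Fintype.card_subtype]
      exact (e c).symm)
  have hp : ∀ j, g.color (p j) = h.color j := fun j => Equiv.ofFiberEquiv_map _ _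
  have hgπ := π_π_of_mul_self hg
  have hhπ := π_π_of_mul_self hh
  let f : Fin n → Fin n := fun j => if h.color j = 1 then g.π (p (h.π j)) else p j
  have hfc : ∀ j, g.color (f j) = h.color j := by
    intro j
    by_cases hj : h.color j = 1
    · have h0 : h.color (h.π j) = 0 := color_eq_zero.2 (by rw [hhπ]; exact color_eq_one.1 hj)
      have h1 := color_eq_zero.1 ((hp (h.π j)).trans h0)
      simp only [f, if_pos hj]
      rw [hj, color_eq_one, hgπ]
      exact h1
    · simp only [f, if_neg hj, hp]
  have hf : Function.Injective f := by
    intro i j hij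
    have hc : h.color i = h.color j := by rw [← hfc, hij, hfc]
    by_cases hj : h.color j = 1
    · simpa [f, hc, hj] using hij
    · simpa [f, hc, hj] using hij
  refine ⟨Equiv.ofBijective f (Finite.injective_iff_bijective.1 hf), fun j => ⟨?_, hfc j⟩⟩
  change g.π (f j) = f (h.π j)
  rcases lt_trichotomy j (h.π j) with hj | hj | hj
  · have h0 : h.color j = 0 := color_eq_zero.2 hj
    have h1 : h.color (h.π j) = 1 := color_eq_one.2 (by rwa [hhπ])
    simp [f, h0, h1, hhπ]
  · have h0 : h.color j ≠ 0 := fun H => (color_eq_zero.1 H).ne hj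
    have h1 : h.color j ≠ 1 := fun H => (color_eq_one.1 H).ne hj.symm
    rw [← hfc, Ne, color_eq_zero] at h0
    rw [← hfc, Ne, color_eq_one] at h1
    rw [← hj]
    exact le_antisymm (not_lt.1 h0) (not_lt.1 h1)
  · have h0 : h.color j = 1 := color_eq_one.2 hj
    have h1 : h.color (h.π j) = 0 := color_eq_zero.2 (by rwa [hhπ])
    simp [f, h0, h1, hgπ]

lemma isConj_of_cycleType_eq {g h : AffineWeylC n} (hg : g * g = 1) (hh : h * h = 1)
    (e : g.cycleType = h.cycleType) : IsConj g h := by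
  refine (isConj_normalize hg).trans (IsConj.trans ?_ (isConj_normalize hh).symm)
  obtain ⟨q, hq⟩ := exists_perm_of_colorCount_eq hg hh (colorCount_eq_of_cycleType_eq hg hh e)
  refine isConj_of_mul_eq (c := ⟨q, 1, 0⟩) ((mul_eq_iff _ _ _).2 fun j => ?_)
  simp [(hq _).1, (hq _).2]

lemma cycleType_eq_of_isConj {g h : AffineWeylC n} (e : IsConj g h) :
    g.cycleType = h.cycleType := by
  obtain ⟨c, hc⟩ := isConj_iff.1 e
  have H := (mul_eq_iff c g h).1 (by rw [← hc, inv_mul_cancel_right])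
  have key : ∀ P Q : Fin n → Prop, (∀ j, P (c.π j) ↔ Q j) →
      {i | P i}.ncard = {i | Q i}.ncard := by
    intro P Q hPQ
    have : {i | P i} = c.π '' {i | Q i} := by
      ext i
      obtain ⟨j, rfl⟩ := c.π.surjective i
      simp [hPQ]
    rw [this, Set.ncard_image_of_injective _ c.π.injective]
  have hfix : ∀ j, g.π (c.π j) = c.π j ↔ h.π j = j := fun j => by
    rw [(H j).1, c.π.injective.eq_iff]
  have hs : ∀ j, h.π j = j → g.s (c.π j) = h.s j := fun j hj => by
    have := (H j).2.1
    rw [hj, mul_comm] at this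
    exact mul_right_cancel this
  have hv : ∀ j, h.π j = j → h.s j = -1 → (Even (g.v (c.π j)) ↔ Even (h.v j)) := by
    intro j hj hsj
    have h3 := (H j).2.2
    rw [(H j).1, hj, hs j hj, hsj] at h3
    rcases Int.units_eq_one_or (c.s j) with h' | h' <;> rw [h'] at h3 <;>
      simp only [Units.val_neg, Units.val_one] at h3 <;> rw [Int.even_iff, Int.even_iff] <;> omega
  simp only [cycleType, numTrans, numNegEven, numNegOdd, numPos, ← Int.not_even_iff_odd,
    Prod.mk.injEq]
  refine ⟨congrArg (· / 2) (key _ _ fun j => not_congr (hfix j)), key _ _ fun j => ?_,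
    key _ _ fun j => ?_, key _ _ fun j => ?_⟩ <;>
    rw [hfix j] <;> refine and_congr_right fun hj => ?_ <;> rw [hs j hj]
  · exact and_congr_right (hv j hj)
  · exact and_congr_right fun hsj => not_congr (hv j hj hsj)

lemma ncard_fin_interval {a b : ℕ} (hb : b ≤ n) :
    {i : Fin n | a ≤ i.val ∧ i.val < b}.ncard = b - a := by
  rw [← Set.ncard_image_of_injective _ Fin.val_injective]
  have : Fin.val '' {i : Fin n | a ≤ i.val ∧ i.val < b} = Set.Ico a b := by
    ext x
    constructor
    · rintro ⟨i, hi, rfl⟩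
      exact hi
    · rintro ⟨h1, h2⟩
      exact ⟨⟨x, h2.trans_le hb⟩, ⟨h1, h2⟩, rfl⟩
  rw [this, ← Finset.coe_Ico, Set.ncard_coe_finset, Nat.card_Ico]

lemma IsCanon.π_ne {a : AffineWeylC n} {m ke ko l : ℕ} (h : a.IsCanon m ke ko l) (i : Fin n)
    (hi : i.val < 2 * m) : a.π i ≠ i := by
  obtain ⟨-, h1, h2, -⟩ := h
  intro e
  have := h1 i hi
  have := h2 i hi
  rw [e] at *
  omega

lemma IsCanon.cycleType_eq {a : AffineWeylC n} {m ke ko l : ℕ} (h : a.IsCanon m ke ko l) :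
    a.cycleType = (m, ke, ko, l) := by
  have hne := h.π_ne
  obtain ⟨hn, -, -, hfix, -, he, ho, hp⟩ := h
  have h1 : (1 : ℤˣ) ≠ -1 := by decide
  have A : {i : Fin n | a.π i ≠ i} = {i | 0 ≤ i.val ∧ i.val < 2 * m} := by
    ext i
    have := hne i
    have := hfix i
    simp only [Set.mem_ofPred_eq]
    grind
  have B : {i : Fin n | a.π i = i ∧ a.s i = -1 ∧ Even (a.v i)} =
      {i | 2 * m ≤ i.val ∧ i.val < 2 * m + ke} := by
    ext i
    have := hne i
    have := hfix i
    have := he i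
    have := ho i
    have := hp i
    simp only [Set.mem_ofPred_eq]
    grind
  have C : {i : Fin n | a.π i = i ∧ a.s i = -1 ∧ Odd (a.v i)} =
      {i | 2 * m + ke ≤ i.val ∧ i.val < 2 * m + ke + ko} := by
    ext i
    have := hne i
    have := hfix i
    have := he i
    have := ho i
    have := hp i
    simp only [Set.mem_ofPred_eq]
    grind
  have D : {i : Fin n | a.π i = i ∧ a.s i = 1} =
      {i | 2 * m + ke + ko ≤ i.val ∧ i.val < n} := by
    ext i
    have := hne i
    have := hfix i
    have := he i
    have := ho i
    have := hp i
    simp only [Set.mem_ofPred_eq]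
    grind
  simp only [cycleType, numTrans, numNegEven, numNegOdd, numPos, A, B, C, D]
  rw [ncard_fin_interval (by omega), ncard_fin_interval (by omega),
    ncard_fin_interval (by omega), ncard_fin_interval le_rfl]
  simp only [Prod.mk.injEq]
  omega

lemma IsCanon.eq {a b : AffineWeylC n} {m ke ko l : ℕ} (ha : a.IsCanon m ke ko l)
    (hb : b.IsCanon m ke ko l) : a = b := by
  obtain ⟨-, a1, a2, a3, a4, a5, a6, a7⟩ := ha
  obtain ⟨-, b1, b2, b3, b4, b5, b6, b7⟩ := hb
  have hsv : ∀ i, a.s i = b.s i ∧ a.v i = b.v i := by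
    intro i
    grind
  refine AffineWeylC.ext (Equiv.ext fun i => ?_) (funext fun i => (hsv i).1)
    (funext fun i => (hsv i).2)
  rcases lt_or_ge i.val (2 * m) with hi | hi
  · rcases Nat.mod_two_eq_zero_or_one i.val with hm | hm
    · exact Fin.ext ((a1 i hi hm).trans (b1 i hi hm).symm)
    · exact Fin.ext ((a2 i hi hm).trans (b2 i hi hm).symm)
  · rw [a3 i hi, b3 i hi]

lemma exists_isCanon {m ke ko l : ℕ} (hn : 2 * m + ke + ko + l = n) :
    ∃ a : AffineWeylC n, a.IsCanon m ke ko l ∧ a * a = 1 := by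
  let f : Fin n → Fin n := fun i =>
    if h : i.val < 2 * m then
      if h' : i.val % 2 = 0 then ⟨i.val + 1, by omega⟩ else ⟨i.val - 1, by omega⟩
    else i
  have f0 : ∀ i : Fin n, i.val < 2 * m → i.val % 2 = 0 → (f i).val = i.val + 1 := by
    intro i h h'
    simp [f, h, h']
  have f1 : ∀ i : Fin n, i.val < 2 * m → i.val % 2 = 1 → (f i).val = i.val - 1 := by
    intro i h h'
    simp [f, h, h']
  have f2 : ∀ i : Fin n, 2 * m ≤ i.val → f i = i := by
    intro i h
    simp [f, not_lt.2 h]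
  have flt : ∀ i : Fin n, i.val < 2 * m → (f i).val < 2 * m := by
    intro i h
    have := f0 i h
    have := f1 i h
    omega
  have hf : Function.Involutive f := by
    intro i
    rcases lt_or_ge i.val (2 * m) with h | h
    · have := f0 i h
      have := f1 i h
      have := f0 (f i) (flt i h)
      have := f1 (f i) (flt i h)
      ext
      omega
    · rw [f2 i h, f2 i h]
  let s : Fin n → ℤˣ := fun i => if 2 * m ≤ i.val ∧ i.val < 2 * m + ke + ko then -1 else 1
  let v : Fin n → ℤ := fun i => if 2 * m + ke ≤ i.val ∧ i.val < 2 * m + ke + ko then 1 else 0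
  have hlow : ∀ i : Fin n, i.val < 2 * m → s i = 1 ∧ v i = 0 := fun i hi =>
    ⟨if_neg (by omega), if_neg (by omega)⟩
  refine ⟨⟨hf.toPerm, s, v⟩, ⟨hn, f0, f1, f2, hlow, fun i hi hi' => ?_, fun i hi hi' => ?_,
    fun i hi => ?_⟩, ?_⟩
  · exact ⟨if_pos (by omega), if_neg (by omega)⟩
  · exact ⟨if_pos (by omega), if_pos (by omega)⟩
  · exact ⟨if_neg (by omega), if_neg (by omega)⟩
  · refine AffineWeylC.ext (Equiv.ext hf) (funext fun i => ?_) (funext fun i => ?_)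
    · change s i * s (f i) = 1
      rcases lt_or_ge i.val (2 * m) with h | h
      · rw [(hlow i h).1, (hlow _ (flt i h)).1, one_mul]
      · rw [f2 i h, Int.units_mul_self]
    · change (s (f i) : ℤ) * v (f i) + v i = 0
      rcases lt_or_ge i.val (2 * m) with h | h
      · rw [(hlow i h).2, (hlow _ (flt i h)).2, mul_zero, add_zero]
      · rw [f2 i h]
        simp only [s, v]
        split_ifs <;> first | omega | simp

end AffineWeylC

/-- Involutions of `G_n` are conjugate iff they have the same
labelled cycle type; in particular every involution is conjugate to exactly one
element of the canonical form `a_{m,k_e,k_o,l}`. -/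
theorem stmt_3 (n : ℕ) :
    (∀ g h : AffineWeylC n, g.Involution → h.Involution →
      (IsConj g h ↔ g.cycleType = h.cycleType)) ∧
    (∀ g : AffineWeylC n, g.Involution →
      ∃! a : AffineWeylC n,
        (∃ m ke ko l : ℕ, a.IsCanon m ke ko l) ∧ IsConj g a) := by
  refine ⟨fun g h hg hh => ⟨AffineWeylC.cycleType_eq_of_isConj,
    AffineWeylC.isConj_of_cycleType_eq hg.2 hh.2⟩, fun g hg => ?_⟩
  obtain ⟨a, ha, ha2⟩ := AffineWeylC.exists_isCanon (AffineWeylC.sum_type_eq hg.2)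
  have hga : IsConj g a := AffineWeylC.isConj_of_cycleType_eq hg.2 ha2 ha.cycleType_eq.symm
  refine ⟨a, ⟨⟨_, _, _, _, ha⟩, hga⟩, ?_⟩
  rintro b ⟨⟨m, ke, ko, l, hb⟩, hgb⟩
  have e := AffineWeylC.cycleType_eq_of_isConj hgb
  rw [hb.cycleType_eq] at e
  simp only [AffineWeylC.cycleType, Prod.mk.injEq] at e
  obtain ⟨rfl, rfl, rfl, rfl⟩ := e
  exact hb.eq ha
end
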